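/- Incompressibility for pure states (entropy form). Let d, D ≥ 1 and n ≥ 1 be natural numbers and let δ be a real number with 0 < δ ≤ 1/(2e). Let E : M_d(ℂ) → M_D(ℂ) be a quantum operation, let ψ_1, …, ψ_n be unit vectors in ℂ^D, and suppose that for every i there exists a density matrix σ_i ∈ M_d(ℂ) with ½‖E(σ_i) − P_{ψ_i}‖₁ ≤ δ. Then log₂ d ≥ S((1/n)·∑_{i=1}^n P_{ψ_i}) − 4δ·log₂((n+1)/(2δ)). (In the paper, d = dim of the space of programs of length ≤ l, so this says that some ψ_i has approximation-complexity exceeding S(avg) minus the stated penalty.) -/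

import Mathlib

open Matrix
open scoped ComplexOrder

open scoped MatrixOrder in
/-- The trace norm `Tr |A|` of a square complex matrix, where `|A|` is the positive
semidefinite square root of `Aᴴ * A`. -/
noncomputable def traceNorm {n : ℕ} (A : Matrix (Fin n) (Fin n) ℂ) : ℝ :=
  (CFC.sqrt (Aᴴ * A)).trace.re

/-- Trace distance: half the trace norm of the difference. -/
noncomputable def traceDist {n : ℕ} (A B : Matrix (Fin n) (Fin n) ℂ) : ℝ :=
  traceNorm (A - B) / 2

/-- A density matrix: positive semidefinite with trace one. -/
def IsDensityMatrix {n : ℕ} (ρ : Matrix (Fin n) (Fin n) ℂ) : Prop :=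
  ρ.PosSemidef ∧ ρ.trace = 1

/-- The rank-one (outer product) matrix `|ψ⟩⟨ψ|` of a vector. -/
noncomputable def projOf {n : ℕ} (ψ : Fin n → ℂ) : Matrix (Fin n) (Fin n) ℂ :=
  Matrix.vecMulVec ψ (star ψ)

/-- Trace preservation for a linear map between matrix algebras. -/
def IsTracePreserving {d D : ℕ}
    (E : Matrix (Fin d) (Fin d) ℂ →ₗ[ℂ] Matrix (Fin D) (Fin D) ℂ) : Prop :=
  ∀ A, (E A).trace = A.trace

/-- Complete positivity: for every `k`, the map `id_k ⊗ E` on block matrices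
preserves positive semidefiniteness. -/
def IsCompletelyPositive {d D : ℕ}
    (E : Matrix (Fin d) (Fin d) ℂ →ₗ[ℂ] Matrix (Fin D) (Fin D) ℂ) : Prop :=
  ∀ (k : ℕ) (A : Matrix (Fin k × Fin d) (Fin k × Fin d) ℂ), A.PosSemidef →
    (Matrix.of fun p q : Fin k × Fin D =>
      E (Matrix.of fun a b => A (p.1, a) (q.1, b)) p.2 q.2).PosSemidef

/-- Von Neumann entropy (binary logarithm) of a matrix: `−∑ λ_i log₂ λ_i` over the
eigenvalues, for Hermitian matrices (with the convention `0 · log₂ 0 = 0`,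
automatic since `Real.logb 2 0 = 0`). -/
noncomputable def vNEntropy {n : ℕ} (ρ : Matrix (Fin n) (Fin n) ℂ) : ℝ :=
  if h : ρ.IsHermitian then -∑ i, h.eigenvalues i * Real.logb 2 (h.eigenvalues i) else 0

section CStar

variable {A : Type*} [CStarAlgebra A] [PartialOrder A] [StarOrderedRing A]

/-- The operator version of the tangent-line bound `log x ≤ log c - 1 + x / c`. -/
lemma cfc_log_le_tangent {a : A} (ha : IsStrictlyPositive a) {c : ℝ} (hc : 0 < c) :
    CFC.log a ≤ (Real.log c - 1) • (1 : A) + c⁻¹ • a := by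
  have hsa : IsSelfAdjoint a := ha.isSelfAdjoint
  have hpos : ∀ x ∈ spectrum ℝ a, 0 < x := fun x hx => by grind
  have h : (Real.log c - 1) • (1 : A) + c⁻¹ • a =
      cfc (fun x : ℝ => (Real.log c - 1) + c⁻¹ * x) a := by
    rw [cfc_const_add .., cfc_const_mul_id .., Algebra.algebraMap_eq_smul_one]
  rw [h, CFC.log]
  refine cfc_mono (fun x hx => ?_)
    (Real.continuousOn_log.mono fun x hx => (hpos x hx).ne') (by fun_prop)
  have hx := hpos x hx
  have := Real.log_le_sub_one_of_pos (show 0 < c⁻¹ * x by positivity)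
  rw [Real.log_mul (by positivity) hx.ne', Real.log_inv] at this
  linarith

/-- The operator version of the chord bound for the concave function `log` on `[s, s + t]`. -/
lemma chord_le_cfc_log {a : A} (ha₀ : 0 ≤ a) (ha₁ : ∀ x ∈ spectrum ℝ a, x ≤ 1) {s t : ℝ}
    (hs : 0 < s) (ht : 0 ≤ t) :
    Real.log s • (1 : A) + (Real.log (s + t) - Real.log s) • a ≤
      CFC.log (t • a + s • (1 : A)) := by
  have hsa : IsSelfAdjoint a := ha₀.isSelfAdjoint
  have hnn : ∀ x ∈ spectrum ℝ a, 0 ≤ x := fun x hx => spectrum_nonneg_of_nonneg ha₀ hx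
  have hpos : ∀ x ∈ spectrum ℝ a, 0 < s + t * x := fun x hx => by
    have := mul_nonneg ht (hnn x hx); linarith
  have h₁ : Real.log s • (1 : A) + (Real.log (s + t) - Real.log s) • a =
      cfc (fun x : ℝ => Real.log s + (Real.log (s + t) - Real.log s) * x) a := by
    rw [cfc_const_add .., cfc_const_mul_id .., Algebra.algebraMap_eq_smul_one]
  have h₂ : t • a + s • (1 : A) = cfc (fun x : ℝ => s + t * x) a := by
    rw [cfc_const_add .., cfc_const_mul_id .., Algebra.algebraMap_eq_smul_one, add_comm]
  have hc : ContinuousOn Real.log ((fun x : ℝ => s + t * x) '' spectrum ℝ a) := by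
    refine Real.continuousOn_log.mono ?_
    rintro _ ⟨x, hx, rfl⟩
    exact (hpos x hx).ne'
  rw [h₁, h₂, CFC.log, ← cfc_comp' Real.log (fun x : ℝ => s + t * x) a hc (by fun_prop)]
  refine cfc_mono (fun x hx => ?_) (by fun_prop)
    (hc.comp (by fun_prop) fun x hx => Set.mem_image_of_mem _ hx)
  have := strictConcaveOn_log_Ioi.concaveOn.2 (Set.mem_Ioi.2 hs)
    (Set.mem_Ioi.2 (show 0 < s + t by linarith)) (sub_nonneg.2 (ha₁ x hx)) (hnn x hx) (by ring)
  simp only [smul_eq_mul] at this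
  rw [show (1 - x) * s + x * (s + t) = s + t * x by ring] at this
  linarith

end CStar

section QuadForm

variable {K : Type*} [Fintype K]

/-- The real part of the expectation value `⟨v, A v⟩`, as a real-linear functional of `A`. -/
noncomputable def quadForm (v : K → ℂ) : Matrix K K ℂ →ₗ[ℝ] ℝ where
  toFun A := (star v ⬝ᵥ A *ᵥ v).re
  map_add' A B := by simp [add_mulVec]
  map_smul' r A := by simp [smul_mulVec]

lemma quadForm_apply (v : K → ℂ) (A : Matrix K K ℂ) :
    quadForm v A = (star v ⬝ᵥ A *ᵥ v).re := rfl

lemma trace_vecMulVec_star_mul (v : K → ℂ) (A : Matrix K K ℂ) :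
    (vecMulVec v (star v) * A).trace = star v ⬝ᵥ A *ᵥ v := by
  rw [vecMulVec_mul, trace_vecMulVec, dotProduct_comm, dotProduct_mulVec]

open scoped MatrixOrder

lemma quadForm_mono (v : K → ℂ) {A B : Matrix K K ℂ} (h : A ≤ B) :
    quadForm v A ≤ quadForm v B := by
  have := (Matrix.le_iff.1 h).re_dotProduct_nonneg v
  rw [← sub_nonneg, ← map_sub]
  exact this

variable [DecidableEq K]

lemma quadForm_one {v : K → ℂ} (hv : star v ⬝ᵥ v = 1) :
    quadForm v (1 : Matrix K K ℂ) = 1 := by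
  simp [quadForm_apply, hv]

lemma quadForm_single (k : K) (A : Matrix K K ℂ) :
    quadForm (Pi.single k 1) A = (A k k).re := by
  simp [quadForm_apply]

lemma spectrum_le_trace {A : Matrix K K ℂ} (hA : A.PosSemidef) :
    ∀ x ∈ spectrum ℝ A, x ≤ A.trace.re := by
  intro x hx
  rw [hA.1.spectrum_real_eq_range_eigenvalues] at hx
  obtain ⟨i, rfl⟩ := hx
  rw [hA.1.trace_eq_sum_eigenvalues, ← RCLike.ofReal_sum, ← RCLike.re_eq_complex_re,
    RCLike.ofReal_re]
  exact Finset.single_le_sum (fun j _ => hA.eigenvalues_nonneg j) (Finset.mem_univ i)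

lemma quadForm_le_trace {A : Matrix K K ℂ} (hA : A.PosSemidef) {v : K → ℂ}
    (hv : star v ⬝ᵥ v = 1) : quadForm v A ≤ A.trace.re := by
  have h : A ≤ algebraMap ℝ _ A.trace.re :=
    le_algebraMap_of_spectrum_le (spectrum_le_trace hA) hA.1
  simpa [Algebra.algebraMap_eq_smul_one, quadForm_one hv] using quadForm_mono v h

end QuadForm

section Real

lemma penalty_le {n : ℕ} (hn : 1 ≤ n) {δ : ℝ} (hδ₀ : 0 < δ) (hδ₁ : δ ≤ 1 / (2 * Real.exp 1)) :
    -(2 * δ * Real.log (δ / n)) - Real.log (δ / n + (1 - δ)) ≤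
      4 * δ * Real.log ((n + 1) / (2 * δ)) := by
  have hn' : (1 : ℝ) ≤ n := by exact_mod_cast hn
  have he := Real.exp_one_gt_d9
  have hδ₂ : δ ≤ 0.2 := hδ₁.trans (by rw [div_le_iff₀ (by positivity)]; linarith)
  have h₁ : -Real.log (δ / n + (1 - δ)) ≤ 1.25 * δ := by
    have h := Real.log_le_log (show 0 < 1 - δ by linarith)
      (show 1 - δ ≤ δ / n + (1 - δ) by linarith [show 0 ≤ δ / n by positivity])
    have h' := Real.one_sub_inv_le_log_of_pos (show 0 < 1 - δ by linarith)
    have : (1 - δ)⁻¹ ≤ 1 + 1.25 * δ := by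
      rw [inv_le_iff_one_le_mul₀ (by linarith)]
      nlinarith
    linarith
  have h₂ : -Real.log (δ / n) ≤ Real.log ((n + 1) / (2 * δ)) + Real.log 2 := by
    rw [← Real.log_mul (by positivity) (by norm_num), ← Real.log_inv]
    refine Real.log_le_log (by positivity) ?_
    rw [inv_div, div_mul_eq_mul_div, div_le_div_iff₀ hδ₀ (by positivity)]
    nlinarith
  have h₃ : 1 + Real.log 2 ≤ Real.log ((n + 1) / (2 * δ)) := by
    rw [← Real.log_exp 1, ← Real.log_mul (by positivity) (by norm_num), Real.log_exp]
    refine Real.log_le_log (by positivity) ?_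
    rw [le_div_iff₀ (by positivity)]
    rw [le_div_iff₀ (by positivity)] at hδ₁
    nlinarith
  have h2 := Real.log_two_gt_d9
  have : 0 ≤ δ * (2 * Real.log ((n + 1) / (2 * δ)) - 2 * Real.log 2 - 1.25) :=
    mul_nonneg hδ₀.le (by linarith)
  nlinarith [mul_le_mul_of_nonneg_left h₂ hδ₀.le]

end Real

section Compression

variable {K : Type*} [Fintype K]

lemma quadForm_conjTranspose_mul_mul {m : Type*} [Fintype m] (V : Matrix m K ℂ) (w : K → ℂ)
    (A : Matrix m m ℂ) : quadForm w (Vᴴ * A * V) = quadForm (V *ᵥ w) A := by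
  rw [quadForm_apply, quadForm_apply, star_mulVec, ← mulVec_mulVec, ← mulVec_mulVec,
    dotProduct_mulVec]

variable [DecidableEq K]

open scoped MatrixOrder Matrix.Norms.L2Operator

/-- Klein's inequality, in coordinates diagonalising the first argument: if `T` is positive
definite with trace at most `d`, then `∑ q_k (log T)_{kk} ≤ log d + ∑ q_k log q_k`. -/
lemma sum_mul_log_diag_le {q : K → ℝ} (hq : ∀ k, 0 < q k) (hq₁ : ∑ k, q k = 1) {d : ℝ}
    (hd : 0 < d) {T : Matrix K K ℂ} (hT : IsStrictlyPositive T) (hTd : T.trace.re ≤ d) :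
    ∑ k, q k * (CFC.log T k k).re ≤ Real.log d + ∑ k, q k * Real.log (q k) := by
  have h : ∀ k, q k * (CFC.log T k k).re ≤
      q k * Real.log d + q k * Real.log (q k) - q k + d⁻¹ * (T k k).re := fun k => by
    have := quadForm_mono (Pi.single k 1) (cfc_log_le_tangent hT (mul_pos hd (hq k)))
    rw [map_add, map_smul, map_smul, quadForm_single, quadForm_single, quadForm_single,
      Real.log_mul hd.ne' (hq k).ne', one_apply_eq, Complex.one_re, smul_eq_mul,
      smul_eq_mul] at this
    refine (mul_le_mul_of_nonneg_left this (hq k).le).trans_eq ?_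
    have := (hq k).ne'
    field_simp
  refine (Finset.sum_le_sum fun k _ => h k).trans ?_
  rw [Finset.sum_add_distrib, Finset.sum_sub_distrib, Finset.sum_add_distrib, ← Finset.sum_mul,
    hq₁, ← Finset.mul_sum, ← Complex.re_sum, one_mul]
  have : d⁻¹ * T.trace.re ≤ 1 := by
    rw [inv_mul_le_iff₀ hd]; linarith
  rw [trace] at this
  simp only [diag_apply] at this
  linarith

/-- The entropy bound in the support of the average state, in coordinates diagonalising it. -/
lemma neg_sum_mul_log_le {n : ℕ} (hn : 1 ≤ n) {d : ℝ} (hd₁ : 1 ≤ d) {δ : ℝ}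
    (hδ₀ : 0 < δ) (hδ₁ : δ ≤ 1 / (2 * Real.exp 1)) (hK : Fintype.card K ≤ n)
    {q : K → ℝ} (hq : ∀ k, 0 < q k) (hq₁ : ∑ k, q k = 1)
    {φ : Fin n → K → ℂ} (hφ : ∀ i, star (φ i) ⬝ᵥ φ i = 1)
    (havg : diagonal (fun k => (q k : ℂ)) = (n : ℂ)⁻¹ • ∑ i, vecMulVec (φ i) (star (φ i)))
    {M : Matrix K K ℂ} (hM : M.trace.re ≤ d) {X : Fin n → Matrix K K ℂ}
    (hX : ∀ i, (X i).PosSemidef) (hX₁ : ∀ i, (X i).trace.re ≤ 1) (hXM : ∀ i, X i ≤ M)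
    (hXφ : ∀ i, 1 - 2 * δ ≤ quadForm (φ i) (X i)) :
    -∑ k, q k * Real.log (q k) ≤ Real.log d + 4 * δ * Real.log ((n + 1) / (2 * δ)) := by
  have hd : 0 < d := by linarith
  have hn₀ : (0 : ℝ) < n := by exact_mod_cast hn
  have hn₁ : (1 : ℝ) ≤ n := by exact_mod_cast hn
  have hδ₂ : δ ≤ 1 := hδ₁.trans <| by
    rw [div_le_one (by positivity)]
    linarith [Real.add_one_le_exp 1]
  have hs : 0 < δ / n := by positivity
  have hs₁ : δ / n ≤ δ := div_le_self hδ₀.le hn₁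
  have ht : 0 ≤ 1 - δ := by linarith
  set L := CFC.log ((1 - δ) • M + (δ / n) • (1 : Matrix K K ℂ))
  have hpos : ∀ {Y : Matrix K K ℂ}, 0 ≤ Y →
      IsStrictlyPositive ((1 - δ) • Y + (δ / n) • (1 : Matrix K K ℂ)) := fun {Y} hY =>
    (IsStrictlyPositive.smul hs isStrictlyPositive_one).nonneg_add (smul_nonneg ht hY)
  have hklein : ∑ k, q k * (L k k).re ≤ Real.log d + ∑ k, q k * Real.log (q k) := by
    refine sum_mul_log_diag_le hq hq₁ hd (hpos ((hX ⟨0, hn⟩).nonneg.trans (hXM _))) ?_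
    have hcard : δ / n * Fintype.card K ≤ δ := by
      rw [div_mul_eq_mul_div, div_le_iff₀ hn₀]
      exact mul_le_mul_of_nonneg_left (by exact_mod_cast hK) hδ₀.le
    have h := mul_le_mul_of_nonneg_left hM ht
    simp only [trace_add, trace_smul, trace_one, Complex.add_re, Complex.smul_re, smul_eq_mul,
      Complex.natCast_re]
    nlinarith
  have hlow : ∀ i, 2 * δ * Real.log (δ / n) + Real.log (δ / n + (1 - δ)) ≤
      quadForm (φ i) L := fun i => by
    have h₁ := chord_le_cfc_log (hX i).nonneg
      (fun x hx => (spectrum_le_trace (hX i) x hx).trans (hX₁ i)) hs ht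
    have h₂ : CFC.log ((1 - δ) • X i + (δ / n) • (1 : Matrix K K ℂ)) ≤ L :=
      CFC.log_le_log (by gcongr; exact hXM i) (hpos (hX i).nonneg)
    have h := quadForm_mono (φ i) (h₁.trans h₂)
    rw [map_add, map_smul, map_smul, quadForm_one (hφ i), smul_eq_mul, smul_eq_mul] at h
    have hf := (quadForm_le_trace (hX i) (hφ i)).trans (hX₁ i)
    have hl₁ := Real.log_nonpos hs.le (show δ / n ≤ 1 by linarith)
    have hl₂ := Real.log_nonpos (show 0 ≤ δ / n + (1 - δ) by linarith) (by linarith)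
    nlinarith [hXφ i]
  have htr : ∑ k, q k * (L k k).re = (n : ℝ)⁻¹ * ∑ i, quadForm (φ i) L := by
    have h := congrArg (fun B => (B * L).trace.re) havg
    simp only [smul_mul, trace_smul, Matrix.sum_mul, trace_sum, trace_vecMulVec_star_mul] at h
    rw [← Complex.ofReal_natCast, ← Complex.ofReal_inv, smul_eq_mul, Complex.re_ofReal_mul,
      Complex.re_sum, trace, Complex.re_sum] at h
    simpa [diagonal_mul, quadForm_apply] using h
  have hsum := Finset.sum_le_sum fun i (_ : i ∈ Finset.univ) => hlow i
  rw [Finset.sum_const, Finset.card_univ, Fintype.card_fin, nsmul_eq_mul] at hsum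
  have := penalty_le hn hδ₀ hδ₁
  rw [htr] at hklein
  have h := (le_inv_mul_iff₀ hn₀).2 hsum
  linarith

end Compression

section Channel

open scoped MatrixOrder

lemma IsCompletelyPositive.map_posSemidef {d D : ℕ}
    {E : Matrix (Fin d) (Fin d) ℂ →ₗ[ℂ] Matrix (Fin D) (Fin D) ℂ} (hE : IsCompletelyPositive E)
    {A : Matrix (Fin d) (Fin d) ℂ} (hA : A.PosSemidef) : (E A).PosSemidef :=
  (hE 1 (A.submatrix Prod.snd Prod.snd) (hA.submatrix _)).submatrix (fun i => (0, i))

lemma IsDensityMatrix.le_one {d : ℕ} {σ : Matrix (Fin d) (Fin d) ℂ} (hσ : IsDensityMatrix σ) :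
    σ ≤ 1 := by
  have h := le_algebraMap_of_spectrum_le (r := (1 : ℝ))
    (fun x hx => (spectrum_le_trace hσ.1 x hx).trans_eq (by rw [hσ.2, Complex.one_re])) hσ.1.1
  rwa [map_one] at h

lemma quadForm_projOf {D : ℕ} {ψ : Fin D → ℂ} (hψ : star ψ ⬝ᵥ ψ = 1) :
    quadForm ψ (projOf ψ) = 1 := by
  rw [quadForm_apply, projOf, vecMulVec_mulVec, hψ]
  simp [hψ]

/-- A state within trace distance `δ` of a pure state has fidelity at least `1 - 2δ` with it. -/
lemma one_sub_le_quadForm_of_traceDist_le {D : ℕ} {ρ : Matrix (Fin D) (Fin D) ℂ}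
    (hρ : ρ.IsHermitian) {ψ : Fin D → ℂ} (hψ : star ψ ⬝ᵥ ψ = 1) {δ : ℝ}
    (h : traceDist ρ (projOf ψ) ≤ δ) : 1 - 2 * δ ≤ quadForm ψ ρ := by
  have hsa : IsSelfAdjoint (ρ - projOf ψ) :=
    hρ.sub (posSemidef_vecMulVec_self_star ψ).1
  have habs : -(ρ - projOf ψ) ≤ CFC.abs (ρ - projOf ψ) := by
    rw [neg_le_iff_add_nonneg, CFC.abs_add_self _ hsa]
    exact nsmul_nonneg (CFC.posPart_nonneg _) 2
  have h₁ := quadForm_mono ψ habs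
  have h₂ := quadForm_le_trace (CFC.abs_nonneg (ρ - projOf ψ)).posSemidef hψ
  have h₃ : (CFC.abs (ρ - projOf ψ)).trace.re = 2 * traceDist ρ (projOf ψ) := by
    rw [traceDist, traceNorm, CFC.abs, star_eq_conjTranspose]; ring
  rw [map_neg, map_sub, quadForm_projOf hψ] at h₁
  linarith

end Channel

section Incompressibility

open scoped MatrixOrder

lemma sum_subtype_eq_sum_of_forall_eq_zero {ι M : Type*} [Fintype ι] [AddCommMonoid M]
    {p : ι → Prop} [DecidablePred p] (f : ι → M) (hf : ∀ i, ¬p i → f i = 0) :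
    ∑ i : {i // p i}, f i = ∑ i, f i := by
  rw [← Fintype.sum_subtype_add_sum_subtype p f,
    Finset.sum_eq_zero (s := Finset.univ (α := {i // ¬p i})) fun i _ => hf i i.2, add_zero]

lemma conjTranspose_mul_vecMulVec_star_mul {m K : Type*} [Fintype m] (V : Matrix m K ℂ)
    (v : m → ℂ) :
    Vᴴ * vecMulVec v (star v) * V = vecMulVec (Vᴴ *ᵥ v) (star (Vᴴ *ᵥ v)) := by
  rw [mul_vecMulVec, vecMulVec_mul, star_mulVec, conjTranspose_conjTranspose]

lemma rank_smul_sum_projOf_le {n D : ℕ} (c : ℂ) (ψ : Fin n → Fin D → ℂ) :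
    (c • ∑ i, projOf (ψ i)).rank ≤ n := by
  have h : c • ∑ i, projOf (ψ i) = (of ψ)ᵀ * (c • (of ψ)ᵀᴴ) := by
    ext a b
    simp [projOf, mul_apply, vecMulVec_apply, Matrix.sum_apply, Finset.mul_sum, mul_left_comm]
  rw [h]
  exact (rank_mul_le_left _ _).trans (by simpa using rank_le_width (of ψ)ᵀ)

/-- An isometry onto the support of a mixture of pure states which diagonalises the mixture. -/
lemma exists_isometry_diagonalizing {n D : ℕ} (hn : 1 ≤ n) (ψ : Fin n → Fin D → ℂ)
    (hρ : ((n : ℂ)⁻¹ • ∑ i, projOf (ψ i)).IsHermitian) :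
    ∃ V : Matrix (Fin D) {k // hρ.eigenvalues k ≠ 0} ℂ,
      diagonal (fun k : {k // hρ.eigenvalues k ≠ 0} => (hρ.eigenvalues k : ℂ)) =
        Vᴴ * ((n : ℂ)⁻¹ • ∑ i, projOf (ψ i)) * V ∧
      (∀ i, V *ᵥ (Vᴴ *ᵥ ψ i) = ψ i) ∧
      ∀ A : Matrix (Fin D) (Fin D) ℂ, A.PosSemidef → (Vᴴ * A * V).trace.re ≤ A.trace.re := by
  set U : Matrix (Fin D) (Fin D) ℂ := hρ.eigenvectorUnitary.1
  have hUU : U * Uᴴ = 1 := Unitary.coe_mul_star_self hρ.eigenvectorUnitary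
  have hdiag : Uᴴ * ((n : ℂ)⁻¹ • ∑ i, projOf (ψ i)) * U =
      diagonal (fun k => (hρ.eigenvalues k : ℂ)) := by
    have h := hρ.conjStarAlgAut_star_eigenvectorUnitary
    rwa [Unitary.conjStarAlgAut_star_apply] at h
  set V : Matrix (Fin D) {k // hρ.eigenvalues k ≠ 0} ℂ := U.submatrix id Subtype.val
  have hVU : ∀ A, Vᴴ * A * V = (Uᴴ * A * U).submatrix Subtype.val Subtype.val := fun A => rfl
  refine ⟨V, ?_, fun i => ?_, fun A hA => ?_⟩
  · rw [hVU, hdiag]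
    exact (submatrix_diagonal (fun k => (hρ.eigenvalues k : ℂ)) _ Subtype.val_injective).symm
  · have hzero : ∀ k, hρ.eigenvalues k = 0 → (Uᴴ *ᵥ ψ i) k = 0 := fun k hk => by
      have h := congrFun₂ hdiag k k
      rw [diagonal_apply_eq, hk, Matrix.mul_smul, Matrix.smul_mul, Matrix.mul_sum,
        Matrix.sum_mul] at h
      simp only [projOf, conjTranspose_mul_vecMulVec_star_mul] at h
      rw [Matrix.smul_apply, Matrix.sum_apply, Complex.ofReal_zero, smul_eq_mul, mul_eq_zero,
        or_iff_right (inv_ne_zero (by exact_mod_cast (by omega : n ≠ 0))),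
        Finset.sum_eq_zero_iff_of_nonneg] at h
      · simpa [vecMulVec_apply] using h i (Finset.mem_univ i)
      · exact fun j _ => mul_star_self_nonneg _
    have h : U *ᵥ (Uᴴ *ᵥ ψ i) = ψ i := by rw [mulVec_mulVec, hUU, one_mulVec]
    conv_rhs => rw [← h]
    ext a
    rw [mulVec, mulVec, dotProduct, dotProduct]
    refine sum_subtype_eq_sum_of_forall_eq_zero (fun k => U a k * (Uᴴ *ᵥ ψ i) k) fun k hk => ?_
    rw [hzero k (not_not.1 hk), mul_zero]
  · have h : A.trace = (Uᴴ * A * U).trace := by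
      rw [trace_mul_cycle, hUU, one_mul]
    have hp := hA.conjTranspose_mul_mul_same U
    rw [h, hVU, trace, trace, Complex.re_sum, Complex.re_sum,
      ← Fintype.sum_subtype_add_sum_subtype (fun k => hρ.eigenvalues k ≠ 0)]
    exact le_add_of_nonneg_right
      (Finset.sum_nonneg fun k _ => (Complex.nonneg_iff.1 hp.diag_nonneg).1)

/-- **Incompressibility for pure states (entropy form).** If each of the unit vectors
`ψ_1, …, ψ_n` is reproduced within trace distance `δ ≤ 1/(2e)` by a quantum operation
`E : M_d(ℂ) → M_D(ℂ)` applied to some density matrix, then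
`log₂ d ≥ S((1/n) ∑ P_{ψ_i}) − 4δ log₂((n+1)/(2δ))`. -/
theorem incompressibility_pure_states
    (d D n : ℕ) (hd : 1 ≤ d) (hD : 1 ≤ D) (hn : 1 ≤ n)
    (δ : ℝ) (hδ0 : 0 < δ) (hδ1 : δ ≤ 1 / (2 * Real.exp 1))
    (E : Matrix (Fin d) (Fin d) ℂ →ₗ[ℂ] Matrix (Fin D) (Fin D) ℂ)
    (hCP : IsCompletelyPositive E) (hTP : IsTracePreserving E)
    (ψ : Fin n → Fin D → ℂ)
    (hunit : ∀ i, star (ψ i) ⬝ᵥ ψ i = 1)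
    (happrox : ∀ i, ∃ σ : Matrix (Fin d) (Fin d) ℂ,
      IsDensityMatrix σ ∧ traceDist (E σ) (projOf (ψ i)) ≤ δ) :
    Real.logb 2 d ≥
      vNEntropy (((n : ℂ))⁻¹ • ∑ i, projOf (ψ i)) -
        4 * δ * Real.logb 2 ((n + 1) / (2 * δ)) := by
  choose σ hσ hdist using happrox
  have hpsd : ((n : ℂ)⁻¹ • ∑ i, projOf (ψ i)).PosSemidef :=
    (posSemidef_sum _ fun i _ => posSemidef_vecMulVec_self_star (ψ i)).smul (by positivity)
  obtain ⟨V, hdiag, hVψ, hVtr⟩ := exists_isometry_diagonalizing hn ψ hpsd.1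
  have hEσ : ∀ i, (E (σ i)).PosSemidef := fun i => hCP.map_posSemidef (hσ i).1
  have hsum : ∑ k : {k // hpsd.1.eigenvalues k ≠ 0}, hpsd.1.eigenvalues k = 1 := by
    have : (diagonal fun k : {k // hpsd.1.eigenvalues k ≠ 0} =>
      (hpsd.1.eigenvalues k : ℂ)).trace = 1 := by
      rw [hdiag, Matrix.mul_smul, Matrix.smul_mul, trace_smul, Matrix.mul_sum,
        Matrix.sum_mul, trace_sum]
      have h : ∀ i, (Vᴴ * projOf (ψ i) * V).trace = 1 := fun i => by
        rw [trace_mul_cycle, trace_mul_comm, projOf, trace_vecMulVec_star_mul, ← mulVec_mulVec,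
          hVψ, hunit]
      have hn' : (n : ℂ) ≠ 0 := by exact_mod_cast (by omega : n ≠ 0)
      simp [h, hn']
    rw [trace_diagonal] at this
    exact_mod_cast this
  have hφ : ∀ i, star (Vᴴ *ᵥ ψ i) ⬝ᵥ (Vᴴ *ᵥ ψ i) = 1 := fun i => by
    rw [star_mulVec, conjTranspose_conjTranspose, ← dotProduct_mulVec, hVψ, hunit]
  have key := neg_sum_mul_log_le hn (d := d) (by exact_mod_cast hd) hδ0 hδ1
    (by rw [← hpsd.1.rank_eq_card_non_zero_eigs]; exact rank_smul_sum_projOf_le _ ψ)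
    (fun k => (hpsd.eigenvalues_nonneg _).lt_of_ne' k.2) hsum hφ
    (by
      rw [hdiag, Matrix.mul_smul, Matrix.smul_mul, Matrix.mul_sum, Matrix.sum_mul]
      exact congrArg _ (Finset.sum_congr rfl fun i _ =>
        conjTranspose_mul_vecMulVec_star_mul V (ψ i)))
    (M := Vᴴ * E 1 * V) (X := fun i => Vᴴ * E (σ i) * V)
    ((hVtr _ (hCP.map_posSemidef .one)).trans (by rw [hTP]; simp))
    (fun i => (hEσ i).conjTranspose_mul_mul_same V)
    (fun i => (hVtr _ (hEσ i)).trans (by rw [hTP, (hσ i).2, Complex.one_re]))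
    (fun i => by
      have h := hCP.map_posSemidef (Matrix.le_iff.1 (hσ i).le_one)
      rw [Matrix.le_iff, ← Matrix.sub_mul, ← Matrix.mul_sub, ← map_sub]
      exact h.conjTranspose_mul_mul_same V)
    (fun i => by
      rw [quadForm_conjTranspose_mul_mul, hVψ]
      exact one_sub_le_quadForm_of_traceDist_le (hEσ i).1 (hunit i) (hdist i))
  have h2 : 0 < Real.log 2 := Real.log_pos one_lt_two
  have hent : vNEntropy ((n : ℂ)⁻¹ • ∑ i, projOf (ψ i)) * Real.log 2 =
      -∑ k : {k // hpsd.1.eigenvalues k ≠ 0},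
        hpsd.1.eigenvalues k * Real.log (hpsd.1.eigenvalues k) := by
    rw [vNEntropy, dif_pos hpsd.1, neg_mul, Finset.sum_mul, neg_inj, ←
      sum_subtype_eq_sum_of_forall_eq_zero (p := fun k => hpsd.1.eigenvalues k ≠ 0) _
        fun k hk => by rw [not_not.1 hk, zero_mul, zero_mul]]
    exact Finset.sum_congr rfl fun k _ => by
      rw [mul_assoc, Real.logb, div_mul_cancel₀ _ h2.ne']
  rw [ge_iff_le, ← mul_le_mul_iff_left₀ h2, sub_mul, hent, mul_assoc, Real.logb, Real.logb,
    div_mul_cancel₀ _ h2.ne', div_mul_cancel₀ _ h2.ne']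
  linarith

end Incompressibility
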